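/- Let α ∈ (0,1/2) and T > 0. If B^H is a fractional Brownian motion with Hurst parameter H ∈ (1/2,1) and 1−H < α, then ‖B^H‖_{0;[0,T]} < ∞ almost surely, and for every constant c > 0 and every q ∈ (0,2), E[ exp{ c · ‖B^H‖_{0;[0,T]}^{q} } ] < ∞; in particular E[ exp{ c · ‖B^H‖_{0;[0,T]}^{1/(1−α)} } ] < ∞. -/

import Mathlib

open MeasureTheory Set
open scoped ENNReal NNReal

/-- The seminorm `‖g‖_{0;[a,b]}`, valued in `ℝ≥0∞`. -/
noncomputable def zeroNorm (α a b : ℝ) (g : ℝ → ℝ) : ℝ≥0∞ :=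
  ⨆ (u : ℝ) (v : ℝ) (_ : a ≤ u) (_ : u < v) (_ : v < b),
    ENNReal.ofReal (|g v - g u| / (v - u) ^ (1 - α)
      + ∫ z in Ioo u v, |g u - g z| / (z - u) ^ (2 - α))

/-- `B` is a fractional Brownian motion with Hurst parameter `H` on `(Ω, P)`:
almost all paths are continuous, every finite linear combination of values is
centered Gaussian, and the covariance is
`E[B_s B_t] = (s^{2H} + t^{2H} - |t-s|^{2H})/2` for `s, t ≥ 0`. -/
def IsFBM {Ω : Type*} [MeasurableSpace Ω] (P : Measure Ω) (H : ℝ)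
    (B : Ω → ℝ → ℝ) : Prop :=
  (∀ᵐ ω ∂P, Continuous (B ω)) ∧
  (∀ (n : ℕ) (c t : Fin n → ℝ), ∃ v : ℝ≥0,
    Measure.map (fun ω => ∑ i, c i * B ω (t i)) P = ProbabilityTheory.gaussianReal 0 v) ∧
  (∀ s t : ℝ, 0 ≤ s → 0 ≤ t
    → (∫ ω, B ω s * B ω t ∂P) = (s ^ (2 * H) + t ^ (2 * H) - |t - s| ^ (2 * H)) / 2)


lemma floor_step (f : ℝ → ℝ) (K r : ℝ)
    (h : ∀ n k : ℕ, k < 2 ^ n → |f (((k:ℝ) + 1) / 2 ^ n) - f ((k:ℝ) / 2 ^ n)| ≤ K * r ^ n)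
    (n a b : ℕ) (hab : a ≤ b) (hb : b ≤ a + 1) (hbn : b < 2 ^ n) (hK : 0 ≤ K * r ^ n) :
    |f ((b:ℝ) / 2 ^ n) - f ((a:ℝ) / 2 ^ n)| ≤ K * r ^ n := by
  rcases Nat.lt_or_ge a b with h1 | h1
  · have : b = a + 1 := by omega
    subst this
    have := h n a (by omega)
    push_cast
    exact this
  · have : a = b := by omega
    subst this
    simpa using hK

lemma chain_point (f : ℝ → ℝ) (hf : Continuous f) (K r : ℝ) (hK : 0 ≤ K) (hr0 : 0 < r)
    (hr1 : r < 1)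
    (h : ∀ n k : ℕ, k < 2 ^ n → |f (((k:ℝ) + 1) / 2 ^ n) - f ((k:ℝ) / 2 ^ n)| ≤ K * r ^ n)
    (x : ℝ) (hx0 : 0 ≤ x) (hx1 : x < 1) (n : ℕ) :
    |f ((⌊(2:ℝ) ^ n * x⌋₊ : ℝ) / 2 ^ n) - f x| ≤ K * r ^ n / (1 - r) := by
  have hlt : ∀ m : ℕ, ⌊(2:ℝ) ^ m * x⌋₊ < 2 ^ m := by
    intro m
    rw [Nat.floor_lt (by positivity)]
    push_cast
    have : (0:ℝ) < 2 ^ m := by positivity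
    nlinarith
  have hlim : Filter.Tendsto (fun m : ℕ => f ((⌊(2:ℝ) ^ m * x⌋₊ : ℝ) / 2 ^ m)) Filter.atTop
      (nhds (f x)) := by
    refine (hf.tendsto x).comp ?_
    have := (tendsto_nat_floor_mul_div_atTop (R := ℝ) hx0).comp
      (tendsto_pow_atTop_atTop_of_one_lt (r := (2:ℝ)) (by norm_num))
    refine this.congr fun m => ?_
    simp [mul_comm]
  have key := dist_le_of_le_geometric_of_tendsto r K hr1 (f := fun m : ℕ => f ((⌊(2:ℝ) ^ m * x⌋₊ : ℝ) / 2 ^ m)) ?_ hlim n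
  · rw [Real.dist_eq] at key; exact key
  · intro m
    rw [Real.dist_eq, abs_sub_comm]
    set j := ⌊(2:ℝ) ^ m * x⌋₊ with hj
    set i := ⌊(2:ℝ) ^ (m+1) * x⌋₊ with hi
    have e : (j:ℝ) / 2 ^ m = ((2 * j : ℕ) : ℝ) / 2 ^ (m+1) := by
      push_cast; rw [pow_succ]; field_simp
    have hpos : (0:ℝ) ≤ 2 ^ m * x := by positivity
    have h1 : (j:ℝ) ≤ 2 ^ m * x := Nat.floor_le hpos
    have h2 : (2:ℝ) ^ m * x < j + 1 := Nat.lt_floor_add_one _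
    have h3 : 2 * j ≤ i := by
      apply Nat.le_floor; push_cast; rw [pow_succ]; linarith
    have h4 : i ≤ 2 * j + 1 := by
      have : i < 2 * j + 2 := by
        rw [hi, Nat.floor_lt (by positivity)]; push_cast; rw [pow_succ]; linarith
      omega
    rw [e]
    refine (floor_step f K r h (m+1) (2*j) i h3 h4 (hlt _) (by positivity)).trans ?_
    rw [pow_succ]
    have : 0 ≤ K * r ^ m := by positivity
    nlinarith

lemma holder_of_dyadic (f : ℝ → ℝ) (hf : Continuous f) (K β : ℝ) (hK : 0 ≤ K) (hβ : 0 < β)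
    (h : ∀ n k : ℕ, k < 2 ^ n →
      |f (((k:ℝ) + 1) / 2 ^ n) - f ((k:ℝ) / 2 ^ n)| ≤ K * ((2:ℝ) ^ (-β)) ^ n)
    (u v : ℝ) (hu : 0 ≤ u) (huv : u < v) (hv : v < 1) :
    |f v - f u| ≤ (2 / (1 - (2:ℝ) ^ (-β)) + 1) * 2 ^ β * K * (v - u) ^ β := by
  set r : ℝ := (2:ℝ) ^ (-β) with hr
  have hr0 : 0 < r := by positivity
  have hr1 : r < 1 := Real.rpow_lt_one_of_one_lt_of_neg (by norm_num) (by linarith)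
  obtain ⟨n, hn1, hn2⟩ := exists_nat_pow_near_of_lt_one (x := v - u) (y := (1/2 : ℝ))
    (by linarith) (by linarith) (by norm_num) (by norm_num)
  have pn : (0:ℝ) < 2 ^ n := by positivity
  have hd : 2 ^ n * (v - u) ≤ 1 := by
    have : (2:ℝ)^n * (1/2)^n = 1 := by rw [← mul_pow]; norm_num
    nlinarith
  have hv1 := chain_point f hf K r hK hr0 hr1 h v (by linarith) hv n
  have hu1 := chain_point f hf K r hK hr0 hr1 h u hu (by linarith) n
  have hm : |f ((⌊(2:ℝ) ^ n * v⌋₊ : ℝ) / 2 ^ n) - f ((⌊(2:ℝ) ^ n * u⌋₊ : ℝ) / 2 ^ n)|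
      ≤ K * r ^ n := by
    apply floor_step f K r h
    · apply Nat.floor_mono; nlinarith
    · have : (2:ℝ)^n * v ≤ 2^n * u + 1 := by nlinarith
      refine (Nat.floor_mono this).trans ?_
      rw [Nat.floor_add_one (by positivity)]
    · rw [Nat.floor_lt (by nlinarith)]
      push_cast
      nlinarith
    · positivity
  have hrn : r ^ n ≤ 2 ^ β * (v - u) ^ β := by
    have : ((1/2:ℝ)^n) ≤ 2 * (v - u) := by rw [pow_succ] at hn1; linarith
    have h5 := Real.rpow_le_rpow (by positivity) this hβ.le
    rw [Real.mul_rpow (by norm_num) (by linarith)] at h5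
    refine le_trans (le_of_eq ?_) h5
    rw [hr, Real.rpow_neg (by norm_num), ← Real.inv_rpow (by norm_num), ← Real.rpow_natCast, ← Real.rpow_natCast, ← Real.rpow_mul (by norm_num),
      ← Real.rpow_mul (by norm_num), mul_comm]
    norm_num
  have h1r : 0 < 1 - r := by linarith
  have tri : |f v - f u| ≤ K * r ^ n / (1 - r) + K * r ^ n / (1 - r) + K * r ^ n := by
    rw [abs_le] at *
    constructor <;> linarith
  calc |f v - f u| ≤ (2 / (1 - r) + 1) * K * r ^ n := by
        refine tri.trans (le_of_eq ?_); ring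
    _ ≤ (2 / (1 - r) + 1) * K * (2 ^ β * (v - u) ^ β) := by gcongr
    _ = _ := by ring

lemma zeroNorm_le (α T β L : ℝ) (g : ℝ → ℝ) (hα : α < 1) (hL : 0 ≤ L) (hβ : 1 - α < β)
    (h : ∀ u v, 0 ≤ u → u < v → v < T → |g v - g u| ≤ L * (v - u) ^ β) :
    zeroNorm α 0 T g ≤
      ENNReal.ofReal (L * (T ^ (β - 1 + α) * (1 + 1 / (β - 1 + α)))) := by
  have hs : 0 < β - 1 + α := by linarith
  unfold zeroNorm
  refine iSup_le fun u => iSup_le fun v => iSup_le fun hu => iSup_le fun huv => iSup_le fun hv => ?_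
  apply ENNReal.ofReal_le_ofReal
  have hd : 0 < v - u := by linarith
  have hT : (v - u) ^ (β - 1 + α) ≤ T ^ (β - 1 + α) :=
    Real.rpow_le_rpow hd.le (by linarith) hs.le
  have h1 : |g v - g u| / (v - u) ^ (1 - α) ≤ L * (v - u) ^ (β - 1 + α) := by
    rw [div_le_iff₀ (by positivity), mul_assoc, ← Real.rpow_add hd,
      show β - 1 + α + (1 - α) = β by ring]
    exact h u v hu huv hv
  have hii : IntervalIntegrable (fun z : ℝ => L * (z - u) ^ (β - 2 + α)) volume u v := by
    have := (intervalIntegral.intervalIntegrable_rpow' (a := 0) (b := v - u) (r := β - 2 + α)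
      (by linarith)).comp_sub_right u
    simp only [zero_add, sub_add_cancel] at this
    exact this.const_mul L
  have hval : ∫ z in u..v, L * (z - u) ^ (β - 2 + α) = L * ((v - u) ^ (β - 1 + α) / (β - 1 + α)) := by
    rw [intervalIntegral.integral_const_mul,
      intervalIntegral.integral_comp_sub_right (fun z => z ^ (β - 2 + α)) u,
      integral_rpow (Or.inl (by linarith)), sub_self]
    have e : β - 2 + α + 1 = β - 1 + α := by ring
    rw [e, Real.zero_rpow hs.ne', sub_zero]
  have h2 : ∫ z in Ioo u v, |g u - g z| / (z - u) ^ (2 - α) ≤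
      L * ((v - u) ^ (β - 1 + α) / (β - 1 + α)) := by
    rw [← hval, intervalIntegral.integral_of_le huv.le, integral_Ioc_eq_integral_Ioo]
    apply integral_mono_of_nonneg
    · filter_upwards [ae_restrict_mem measurableSet_Ioo] with z hz
      have : 0 < z - u := by linarith [hz.1]
      simp only [Pi.zero_apply]
      positivity
    · rw [intervalIntegrable_iff_integrableOn_Ioo_of_le huv.le] at hii
      exact hii
    · filter_upwards [ae_restrict_mem measurableSet_Ioo] with z hz
      have hz0 : 0 < z - u := by linarith [hz.1]
      rw [div_le_iff₀ (by positivity), mul_assoc, ← Real.rpow_add hz0, abs_sub_comm,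
        show β - 2 + α + (2 - α) = β by ring]
      exact h u z hu hz.1 (by linarith [hz.2])
  calc _ ≤ L * (v - u) ^ (β - 1 + α) + L * ((v - u) ^ (β - 1 + α) / (β - 1 + α)) := add_le_add h1 h2
    _ = L * ((v - u) ^ (β - 1 + α) * (1 + 1 / (β - 1 + α))) := by ring
    _ ≤ _ := by gcongr

lemma pow_q_le (c q l : ℝ) (hc : 0 < c) (hq : 0 < q) (hq2 : q < 2) (hl : 0 < l) :
    ∃ C : ℝ, ∀ x : ℝ, 0 ≤ x → c * x ^ q ≤ l * x ^ 2 + C := by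
  set A : ℝ := (l / c) ^ (1 / (q - 2)) with hA
  have hA0 : 0 < A := by positivity
  have hAq : A ^ (q - 2) = l / c := by
    rw [hA, ← Real.rpow_mul (by positivity), one_div, inv_mul_cancel₀ (by linarith), Real.rpow_one]
  refine ⟨c * A ^ q, fun x hx => ?_⟩
  rcases le_total x A with h | h
  · have : x ^ q ≤ A ^ q := Real.rpow_le_rpow hx h hq.le
    have : c * x ^ q ≤ c * A ^ q := by gcongr
    nlinarith [mul_nonneg hl.le (sq_nonneg x)]
  · have hx0 : 0 < x := by linarith
    have e : x ^ q = x ^ (q - 2) * x ^ 2 := by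
      rw [← Real.rpow_natCast, ← Real.rpow_add hx0]; norm_num
    have h3 : x ^ (q - 2) ≤ l / c := by
      rw [← hAq]; exact Real.rpow_le_rpow_of_nonpos hA0 h (by linarith)
    have : c * x ^ q ≤ l * x ^ 2 := by
      rw [e]
      calc c * (x ^ (q - 2) * x ^ 2) ≤ c * (l / c * x ^ 2) := by gcongr
        _ = _ := by field_simp
    have : 0 < c * A ^ q := by positivity
    linarith

lemma gauss_exp_lt_top :
    ∫⁻ x, ENNReal.ofReal (Real.exp (x ^ 2 / 4)) ∂(ProbabilityTheory.gaussianReal 0 1) < ⊤ := by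
  rw [ProbabilityTheory.gaussianReal_of_var_ne_zero _ (by norm_num),
    lintegral_withDensity_eq_lintegral_mul _ (by fun_prop) (by fun_prop)]
  have hi : Integrable (fun x : ℝ => (√(2 * Real.pi))⁻¹ * Real.exp (-(1/4) * x ^ 2)) :=
    (integrable_exp_neg_mul_sq (by norm_num)).const_mul _
  refine lt_of_le_of_lt (le_of_eq ?_) hi.lintegral_lt_top
  apply lintegral_congr
  intro x
  simp only [Pi.mul_apply, ProbabilityTheory.gaussianPDF, ProbabilityTheory.gaussianPDFReal]
  rw [← ENNReal.ofReal_mul (by positivity), mul_assoc, ← Real.exp_add]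
  norm_num
  ring_nf

lemma gauss_scaled {Ω : Type*} [MeasurableSpace Ω] (P : Measure Ω) [IsProbabilityMeasure P]
    (X : Ω → ℝ) (v : ℝ≥0) (hv : v ≠ 0)
    (hX : Measure.map X P = ProbabilityTheory.gaussianReal 0 v) :
    ∫⁻ ω, ENNReal.ofReal (Real.exp (X ω ^ 2 / (4 * v))) ∂P =
      ∫⁻ x, ENNReal.ofReal (Real.exp (x ^ 2 / 4)) ∂(ProbabilityTheory.gaussianReal 0 1) := by
  have hm : AEMeasurable X P := by
    apply AEMeasurable.of_map_ne_zero
    rw [hX]; exact IsProbabilityMeasure.ne_zero _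
  have hvr : (0:ℝ) < v := by positivity
  have e : ProbabilityTheory.gaussianReal 0 1 =
      Measure.map (fun x => (√v)⁻¹ * x) (ProbabilityTheory.gaussianReal 0 v) := by
    rw [ProbabilityTheory.gaussianReal_map_const_mul]
    congr 1
    · simp
    · ext
      simp [hvr.ne', Real.sq_sqrt hvr.le]
  rw [e, ← hX, lintegral_map (by fun_prop) (by fun_prop), lintegral_map' (by fun_prop) hm]
  apply lintegral_congr
  intro ω
  congr 2
  rw [mul_pow, inv_pow, Real.sq_sqrt hvr.le]
  field_simp

lemma fbm_incr {Ω : Type*} [MeasurableSpace Ω] (P : Measure Ω) [IsProbabilityMeasure P]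
    (H : ℝ) (hH : 0 < H) (B : Ω → ℝ → ℝ) (hB : IsFBM P H B) (s t : ℝ) (hs : 0 ≤ s) (hst : s < t) :
    Measure.map (fun ω => B ω t - B ω s) P =
      ProbabilityTheory.gaussianReal 0 (((t - s) ^ (2 * H)).toNNReal) := by
  obtain ⟨-, hG, hC⟩ := hB
  have hmap : ∀ t, ∃ v : ℝ≥0, Measure.map (fun ω => B ω t) P = ProbabilityTheory.gaussianReal 0 v := by
    intro t
    obtain ⟨v, hv⟩ := hG 1 (fun _ => 1) (fun _ => t)
    exact ⟨v, by simpa using hv⟩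
  have hLp : ∀ Y : Ω → ℝ, (∃ v : ℝ≥0, Measure.map Y P = ProbabilityTheory.gaussianReal 0 v) →
      AEMeasurable Y P ∧ MemLp Y 2 P := by
    rintro Y ⟨v, hv⟩
    have hm : AEMeasurable Y P := by
      apply AEMeasurable.of_map_ne_zero
      rw [hv]; exact IsProbabilityMeasure.ne_zero _
    refine ⟨hm, ?_⟩
    have := ProbabilityTheory.memLp_id_gaussianReal (μ := 0) (v := v) 2
    rw [← hv] at this
    exact (memLp_map_measure_iff (by fun_prop) hm).1 this
  obtain ⟨v, hv⟩ := hG 2 ![1, -1] ![t, s]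
  have hv' : Measure.map (fun ω => B ω t - B ω s) P = ProbabilityTheory.gaussianReal 0 v := by
    rw [← hv]; congr 1; ext ω; simp [Fin.sum_univ_two]; ring
  rw [hv']
  congr 1
  have hm := (hLp _ ⟨v, hv'⟩).1
  have ht2 := (hLp _ (hmap t)).2
  have hs2 := (hLp _ (hmap s)).2
  have hvar : ∫ ω, (B ω t - B ω s) ^ 2 ∂P = v := by
    have h1 := ProbabilityTheory.variance_id_gaussianReal (μ := 0) (v := v)
    rw [ProbabilityTheory.variance_eq_integral (by fun_prop)] at h1
    simp only [id, ProbabilityTheory.integral_id_gaussianReal, sub_zero] at h1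
    rw [← hv', integral_map hm (by fun_prop)] at h1
    exact h1
  have hexp : ∫ ω, (B ω t - B ω s) ^ 2 ∂P = (t - s) ^ (2 * H) := by
    have e : ∀ ω, (B ω t - B ω s) ^ 2 = B ω t * B ω t - 2 * (B ω s * B ω t) + B ω s * B ω s := by
      intro ω; ring
    simp_rw [e]
    have i1 : Integrable (fun ω => B ω t * B ω t) P := ht2.integrable_mul ht2
    have i2 : Integrable (fun ω => B ω s * B ω t) P := hs2.integrable_mul ht2
    have i3 : Integrable (fun ω => B ω s * B ω s) P := hs2.integrable_mul hs2
    have i4 : Integrable (fun ω => B ω t * B ω t - 2 * (B ω s * B ω t)) P := i1.sub (i2.const_mul 2)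
    rw [integral_add i4 i3, integral_sub i1 (i2.const_mul 2),
      integral_const_mul, hC t t (by linarith) (by linarith), hC s t hs (by linarith), hC s s hs hs]
    rw [sub_self, sub_self, abs_zero, Real.zero_rpow (by linarith), abs_of_pos (by linarith : 0 < t - s)]
    ring
  ext
  rw [← hvar, hexp, Real.coe_toNNReal _ (by apply Real.rpow_nonneg; linarith)]

lemma dyadic_bound (T H β : ℝ) (hT : 0 < T) (hβH : β < H) :
    ∃ A : ℝ, 0 < A ∧ ∀ (n : ℕ) (l x : ℝ), 0 ≤ l →
      x ^ 2 ≤ (T / 2 ^ n) ^ (2 * H) * (4 * (l + n * Real.log 4)) →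
      |x| ≤ √(A * (l + 1)) * ((2:ℝ) ^ (-β)) ^ n := by
  set δ : ℝ := (2:ℝ) ^ (2 * (β - H)) with hδ
  have hδ0 : 0 < δ := by positivity
  have hδ1 : δ < 1 := Real.rpow_lt_one_of_one_lt_of_neg (by norm_num) (by linarith)
  obtain ⟨M, hM⟩ := (tendsto_self_mul_const_pow_of_lt_one hδ0.le hδ1).bddAbove_range
  have hM' : ∀ n : ℕ, n * δ ^ n ≤ M := fun n => hM ⟨n, rfl⟩
  have hM0 : 0 ≤ M := by simpa using hM' 0
  have hlog : 0 < Real.log 4 := Real.log_pos (by norm_num)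
  refine ⟨T ^ (2 * H) * (4 * (1 + M * Real.log 4)), by positivity, fun n l x hl hx => ?_⟩
  have e : (T / 2 ^ n) ^ (2 * H) = T ^ (2 * H) * (δ ^ n * (((2:ℝ) ^ (-β)) ^ n) ^ 2) := by
    rw [Real.div_rpow hT.le (by positivity), div_eq_mul_inv]
    congr 1
    rw [← Real.rpow_neg (by positivity), ← pow_mul, mul_comm n 2, pow_mul, ← mul_pow, hδ,
      ← Real.rpow_natCast ((2:ℝ) ^ (-β)) 2, ← Real.rpow_mul (by norm_num),
      ← Real.rpow_add (by norm_num), ← Real.rpow_natCast, ← Real.rpow_mul (by norm_num),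
      ← Real.rpow_natCast, ← Real.rpow_mul (by norm_num)]
    congr 1
    push_cast
    ring
  apply abs_le_of_sq_le_sq _ (by positivity)
  rw [mul_pow, Real.sq_sqrt (by positivity)]
  refine hx.trans ?_
  rw [e]
  have h1 : δ ^ n * (l + n * Real.log 4) ≤ (1 + M * Real.log 4) * (l + 1) := by
    have a1 : δ ^ n * l ≤ l := mul_le_of_le_one_left hl (pow_le_one₀ hδ0.le hδ1.le)
    have a2 : (n * δ ^ n) * Real.log 4 ≤ M * Real.log 4 := by gcongr; exact hM' n
    have a3 : 0 ≤ M * Real.log 4 * l := by positivity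
    nlinarith
  calc T ^ (2 * H) * (δ ^ n * (((2:ℝ) ^ (-β)) ^ n) ^ 2) * (4 * (l + n * Real.log 4))
      = T ^ (2 * H) * 4 * (((2:ℝ) ^ (-β)) ^ n) ^ 2 * (δ ^ n * (l + n * Real.log 4)) := by ring
    _ ≤ T ^ (2 * H) * 4 * (((2:ℝ) ^ (-β)) ^ n) ^ 2 * ((1 + M * Real.log 4) * (l + 1)) := by gcongr
    _ = _ := by ring

lemma fbm_core {Ω : Type*} [MeasurableSpace Ω]
    (P : Measure Ω) [IsProbabilityMeasure P] (α T H : ℝ) (B : Ω → ℝ → ℝ)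
    (hα : α ∈ Set.Ioo (0 : ℝ) (1 / 2)) (hT : 0 < T)
    (hH : H ∈ Set.Ioo (1 / 2 : ℝ) 1) (hHα : 1 - H < α)
    (hB : IsFBM P H B) :
    ∃ (C : ℝ) (R : Ω → ℝ≥0∞), 0 < C ∧ ∫⁻ ω, R ω ∂P < ⊤ ∧ ∀ᵐ ω ∂P, R ω ≠ ⊤ ∧ 1 ≤ (R ω).toReal ∧
      zeroNorm α 0 T (B ω) < ⊤ ∧
      (zeroNorm α 0 T (B ω)).toReal ^ 2 ≤ C * (Real.log (R ω).toReal + 1) := by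
  obtain ⟨hα0, hα1⟩ := hα
  obtain ⟨hH0, hH1⟩ := hH
  obtain ⟨β, hβ1, hβ2⟩ := exists_between (show 1 - α < H by linarith)
  have hβ0 : 0 < β := by linarith
  obtain ⟨A, hA, hAb⟩ := dyadic_bound T H β hT hβ2
  set X : ℕ → ℕ → Ω → ℝ := fun n k ω => B ω (T * (((k:ℝ) + 1) / 2 ^ n)) - B ω (T * ((k:ℝ) / 2 ^ n)) with hX
  set V : ℕ → ℝ := fun n => (T / 2 ^ n) ^ (2 * H) with hV
  have hVpos : ∀ n, 0 < V n := fun n => by simp only [hV]; positivity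
  have hlaw : ∀ n k, Measure.map (X n k) P = ProbabilityTheory.gaussianReal 0 (V n).toNNReal := by
    intro n k
    have := fbm_incr P H (by linarith) B hB (T * ((k:ℝ) / 2 ^ n)) (T * (((k:ℝ) + 1) / 2 ^ n))
      (by positivity) (by gcongr; linarith)
    rw [hX, this]
    congr 3
    ring
  have hXm : ∀ n k, AEMeasurable (X n k) P := by
    intro n k
    apply AEMeasurable.of_map_ne_zero
    rw [hlaw]; exact IsProbabilityMeasure.ne_zero _
  set G : ℕ → ℕ → Ω → ℝ≥0∞ := fun n k ω => ENNReal.ofReal (Real.exp (X n k ω ^ 2 / (4 * V n))) with hG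
  set M := ∫⁻ x, ENNReal.ofReal (Real.exp (x ^ 2 / 4)) ∂(ProbabilityTheory.gaussianReal 0 1) with hM
  have hGint : ∀ n k, ∫⁻ ω, G n k ω ∂P = M := by
    intro n k
    have := gauss_scaled P (X n k) (V n).toNNReal (by simpa using hVpos n) (hlaw n k)
    rw [Real.coe_toNNReal _ (hVpos n).le] at this
    exact this
  have hGm : ∀ n k, AEMeasurable (G n k) P := by
    intro n k
    have := hXm n k
    simp only [hG]
    fun_prop
  set R : Ω → ℝ≥0∞ := fun ω => ∑' n : ℕ, (4⁻¹ : ℝ≥0∞) ^ n * ∑ k ∈ Finset.range (2 ^ n), G n k ω with hR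
  have hRm : AEMeasurable R P := by
    simp only [hR]
    refine AEMeasurable.tsum fun n => ?_
    refine AEMeasurable.const_mul ?_ _
    exact Finset.aemeasurable_fun_sum _ fun k _ => hGm n k
  have hRint : ∫⁻ ω, R ω ∂P < ⊤ := by
    simp only [hR]
    rw [lintegral_tsum fun n => AEMeasurable.const_mul (Finset.aemeasurable_fun_sum _ fun k _ => hGm n k) _]
    have : ∀ n : ℕ, ∫⁻ ω, (4⁻¹ : ℝ≥0∞) ^ n * ∑ k ∈ Finset.range (2 ^ n), G n k ω ∂P = 2⁻¹ ^ n * M := by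
      intro n
      rw [lintegral_const_mul'' _ (Finset.aemeasurable_fun_sum _ fun k _ => hGm n k),
        lintegral_finsetSum' _ fun k _ => hGm n k]
      simp only [hGint, Finset.sum_const, Finset.card_range, nsmul_eq_mul]
      push_cast
      rw [← mul_assoc, ← mul_pow]
      congr 2
      rw [show (4:ℝ≥0∞) = 2 * 2 by norm_num, ENNReal.mul_inv (by simp) (by simp), mul_assoc,
        ENNReal.inv_mul_cancel (by simp) (by simp), mul_one]
    simp_rw [this]
    rw [ENNReal.tsum_mul_right, ENNReal.tsum_geometric]
    refine ENNReal.mul_lt_top ?_ gauss_exp_lt_top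
    simp
  set D : ℝ := (2 / (1 - (2:ℝ) ^ (-β)) + 1) * 2 ^ β with hD
  have hr1 : (2:ℝ) ^ (-β) < 1 := Real.rpow_lt_one_of_one_lt_of_neg (by norm_num) (by linarith)
  have hD0 : 0 < D := by
    have : 0 < 1 - (2:ℝ) ^ (-β) := by linarith
    positivity
  have hs : 0 < β - 1 + α := by linarith
  set E : ℝ := D * (T⁻¹ ^ β) * (T ^ (β - 1 + α) * (1 + 1 / (β - 1 + α))) with hE
  have hE0 : 0 < E := by positivity
  refine ⟨E ^ 2 * A, R, by positivity, hRint, ?_⟩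
  filter_upwards [ae_lt_top' hRm hRint.ne, hB.1] with ω hω hc
  have hRne : R ω ≠ ⊤ := hω.ne
  have hterm : ∀ n k : ℕ, k < 2 ^ n → (4⁻¹ : ℝ≥0∞) ^ n * G n k ω ≤ R ω := by
    intro n k hk
    refine le_trans ?_ (ENNReal.le_tsum n)
    gcongr
    exact Finset.single_le_sum (f := fun k => G n k ω) (fun _ _ => zero_le) (Finset.mem_range.2 hk)
  have hterm' : ∀ n k : ℕ, k < 2 ^ n →
      (4⁻¹ : ℝ) ^ n * Real.exp (X n k ω ^ 2 / (4 * V n)) ≤ (R ω).toReal := by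
    intro n k hk
    have := ENNReal.toReal_mono hRne (hterm n k hk)
    simpa [hG, ENNReal.toReal_mul, ENNReal.toReal_pow, ENNReal.toReal_inv,
      ENNReal.toReal_ofReal (Real.exp_pos _).le] using this
  have hR1 : 1 ≤ (R ω).toReal := by
    have h0 := hterm' 0 0 (by norm_num)
    rw [pow_zero, one_mul] at h0
    refine le_trans (Real.one_le_exp ?_) h0
    have := hVpos 0
    positivity
  have hlog0 : 0 ≤ Real.log (R ω).toReal := Real.log_nonneg hR1
  set K : ℝ := √(A * (Real.log (R ω).toReal + 1)) with hK
  have hdy : ∀ n k : ℕ, k < 2 ^ n → |X n k ω| ≤ K * ((2:ℝ) ^ (-β)) ^ n := by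
    intro n k hk
    apply hAb n _ _ hlog0
    have h1 := Real.log_le_log (by positivity) (hterm' n k hk)
    rw [Real.log_mul (by positivity) (by positivity), Real.log_exp, Real.log_pow, Real.log_inv] at h1
    have h2 : X n k ω ^ 2 / (4 * V n) ≤ Real.log (R ω).toReal + n * Real.log 4 := by linarith
    rw [div_le_iff₀ (by have := hVpos n; positivity)] at h2
    refine h2.trans (le_of_eq ?_)
    simp only [hV]; ring
  have hhol : ∀ u v, 0 ≤ u → u < v → v < T → |B ω v - B ω u| ≤ (D * (T⁻¹ ^ β) * K) * (v - u) ^ β := by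
    intro u v hu huv hv
    have := holder_of_dyadic (fun x => B ω (T * x)) (by fun_prop) K β (by positivity) hβ0 hdy
      (u / T) (v / T) (by positivity) (by gcongr) (by rwa [div_lt_one hT])
    simp only [mul_div_cancel₀ _ hT.ne'] at this
    refine this.trans (le_of_eq ?_)
    rw [← sub_div, div_eq_inv_mul (v - u) T, Real.mul_rpow (by positivity) (by linarith)]
    ring
  have hz := zeroNorm_le α T β (D * (T⁻¹ ^ β) * K) (B ω) (by linarith) (by positivity) hβ1 hhol
  refine ⟨hRne, hR1, hz.trans_lt ENNReal.ofReal_lt_top, ?_⟩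
  have hz2 := ENNReal.toReal_mono ENNReal.ofReal_ne_top hz
  rw [ENNReal.toReal_ofReal (by positivity)] at hz2
  have hz3 : (zeroNorm α 0 T (B ω)).toReal ≤ E * K := hz2.trans (le_of_eq (by simp only [hE]; ring))
  calc _ ≤ (E * K) ^ 2 := by gcongr
    _ = _ := by rw [mul_pow, hK, Real.sq_sqrt (by positivity)]; ring

theorem exp_moments_of_zeroNorm_fbm {Ω : Type*} [MeasurableSpace Ω]
    (P : Measure Ω) [IsProbabilityMeasure P] (α T H : ℝ) (B : Ω → ℝ → ℝ)
    (hα : α ∈ Set.Ioo (0 : ℝ) (1 / 2)) (hT : 0 < T)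
    (hH : H ∈ Set.Ioo (1 / 2 : ℝ) 1) (hHα : 1 - H < α)
    (hB : IsFBM P H B) :
    (∀ᵐ ω ∂P, zeroNorm α 0 T (B ω) < ⊤) ∧
    (∀ c : ℝ, 0 < c → ∀ q : ℝ, 0 < q → q < 2 →
      (∫⁻ ω, ENNReal.ofReal
        (Real.exp (c * (zeroNorm α 0 T (B ω)).toReal ^ q)) ∂P) < ⊤) ∧
    (∀ c : ℝ, 0 < c →
      (∫⁻ ω, ENNReal.ofReal
        (Real.exp (c * (zeroNorm α 0 T (B ω)).toReal ^ (1 / (1 - α)))) ∂P) < ⊤) := by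
  obtain ⟨C, R, hC, hRint, hae⟩ := fbm_core P α T H B hα hT hH hHα hB
  have main : ∀ c : ℝ, 0 < c → ∀ q : ℝ, 0 < q → q < 2 →
      (∫⁻ ω, ENNReal.ofReal
        (Real.exp (c * (zeroNorm α 0 T (B ω)).toReal ^ q)) ∂P) < ⊤ := by
    intro c hc q hq hq2
    obtain ⟨D, hD⟩ := pow_q_le c q (1 / C) hc hq hq2 (by positivity)
    have hfin : ∫⁻ ω, ENNReal.ofReal (Real.exp (1 + D)) * R ω ∂P < ⊤ := by
      rw [lintegral_const_mul' _ _ ENNReal.ofReal_ne_top]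
      exact ENNReal.mul_lt_top ENNReal.ofReal_lt_top hRint
    refine lt_of_le_of_lt (lintegral_mono_ae ?_) hfin
    filter_upwards [hae] with ω ⟨h1, h2, h3, h4⟩
    rw [← ENNReal.ofReal_toReal h1, ← ENNReal.ofReal_mul (by positivity)]
    apply ENNReal.ofReal_le_ofReal
    have h5 := hD _ (ENNReal.toReal_nonneg (a := zeroNorm α 0 T (B ω)))
    have h6 : 1 / C * (zeroNorm α 0 T (B ω)).toReal ^ 2 ≤ Real.log (R ω).toReal + 1 := by
      rw [one_div, inv_mul_le_iff₀ hC]; exact h4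
    calc _ ≤ Real.exp ((1 + D) + Real.log (R ω).toReal) := Real.exp_le_exp.2 (by linarith)
      _ = _ := by rw [Real.exp_add, Real.exp_log (by linarith)]
  refine ⟨hae.mono fun ω h => h.2.2.1, main, fun c hc => main c hc _ ?_ ?_⟩
  · have := hα.2
    apply one_div_pos.2; linarith
  · have := hα.2
    rw [div_lt_iff₀ (by linarith)]; linarith
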